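/- Let S = {(0,2),(0,3),(0,4),(1,0),(1,2),(2,1),(2,2),(2,4),(3,0),(3,2),(4,1),(4,3),(4,4)} ⊆ ℕ×ℕ. The generalised toric code C_S over the field with 8 elements has minimum distance exactly 27: every nonzero codeword of C_S has Hamming weight at least 27, and some codeword of C_S has Hamming weight exactly 27. -/

import Mathlib

/-- `F8` is the finite field with 8 elements, `GF(2,3)`. -/
abbrev F8 : Type := GaloisField 2 3

/-- The evaluation vector of an exponent pair `(a, b)`: the function
`F8ˣ × F8ˣ → F8` sending `(x, y)` to `x ^ a * y ^ b`. -/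
noncomputable def evalVec (ab : ℕ × ℕ) : F8ˣ × F8ˣ → F8 :=
  fun xy => (xy.1 : F8) ^ ab.1 * (xy.2 : F8) ^ ab.2

/-- The Hamming weight of a vector `c : F8ˣ × F8ˣ → F8`: the number of
coordinates at which `c` is nonzero. -/
noncomputable def hammingWeight (c : F8ˣ × F8ˣ → F8) : ℕ :=
  Nat.card {p : F8ˣ × F8ˣ // c p ≠ 0}

/-- The set of exponent vectors. -/
def S : Set (ℕ × ℕ) := {(0,2),(0,3),(0,4),(1,0),(1,2),(2,1),(2,2),(2,4),(3,0),(3,2),(4,1),(4,3),(4,4)}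

/-- A concrete model of the field with eight elements; `c_i` stands for the
polynomial over `F₂` whose coefficients are the binary digits of `i`, modulo `X^3+X+1`. -/
inductive K8 : Type
  | c0 | c1 | c2 | c3 | c4 | c5 | c6 | c7
  deriving DecidableEq

namespace K8

instance : Fintype K8 :=
  ⟨{c0, c1, c2, c3, c4, c5, c6, c7}, by intro x; cases x <;> decide⟩

/-- Selection by a field element. -/
noncomputable def sel {α : Type} (a0 a1 a2 a3 a4 a5 a6 a7 : α) (v : K8) : α :=
  @K8.rec (fun _ => α) a0 a1 a2 a3 a4 a5 a6 a7 v

noncomputable def add (a b : K8) : K8 :=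
  sel
    (sel c0 c1 c2 c3 c4 c5 c6 c7 b)
    (sel c1 c0 c3 c2 c5 c4 c7 c6 b)
    (sel c2 c3 c0 c1 c6 c7 c4 c5 b)
    (sel c3 c2 c1 c0 c7 c6 c5 c4 b)
    (sel c4 c5 c6 c7 c0 c1 c2 c3 b)
    (sel c5 c4 c7 c6 c1 c0 c3 c2 b)
    (sel c6 c7 c4 c5 c2 c3 c0 c1 b)
    (sel c7 c6 c5 c4 c3 c2 c1 c0 b)
    a

noncomputable def mul (a b : K8) : K8 :=
  sel
    (sel c0 c0 c0 c0 c0 c0 c0 c0 b)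
    (sel c0 c1 c2 c3 c4 c5 c6 c7 b)
    (sel c0 c2 c4 c6 c3 c1 c7 c5 b)
    (sel c0 c3 c6 c5 c7 c4 c1 c2 b)
    (sel c0 c4 c3 c7 c6 c2 c5 c1 b)
    (sel c0 c5 c1 c4 c2 c7 c3 c6 b)
    (sel c0 c6 c7 c1 c5 c3 c2 c4 b)
    (sel c0 c7 c5 c2 c1 c6 c4 c3 b)
    a

noncomputable def inv (a : K8) : K8 := sel c0 c1 c5 c6 c7 c2 c3 c4 a

noncomputable instance : Add K8 := ⟨add⟩
noncomputable instance : Mul K8 := ⟨mul⟩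
noncomputable instance : Neg K8 := ⟨fun a => a⟩
noncomputable instance : Inv K8 := ⟨inv⟩
instance : Zero K8 := ⟨c0⟩
instance : One K8 := ⟨c1⟩

noncomputable instance : Field K8 :=
  Field.ofMinimalAxioms K8
    (by intro a b c; cases a <;> cases b <;> cases c <;> rfl)
    (by intro a; cases a <;> rfl)
    (by intro a; cases a <;> rfl)
    (by intro a b c; cases a <;> cases b <;> cases c <;> rfl)
    (by intro a b; cases a <;> cases b <;> rfl)
    (by intro a; cases a <;> rfl)
    (by intro a h; cases a <;> first | rfl | exact absurd rfl h)
    rfl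
    (by intro a b c; cases a <;> cases b <;> cases c <;> rfl)
    ⟨c0, c1, by intro h; cases h⟩

theorem add_def (a b : K8) : add a b = a + b := rfl
theorem mul_def (a b : K8) : mul a b = a * b := rfl
theorem inv_def (a : K8) : inv a = a⁻¹ := rfl
theorem zero_def : (c0 : K8) = 0 := rfl
theorem one_def : (c1 : K8) = 1 := rfl

/-- Sum over the nonzero field elements. -/
def sum7 (f : K8 → ℕ) : ℕ :=
  Nat.add (f c1) (Nat.add (f c2) (Nat.add (f c3) (Nat.add (f c4)
    (Nat.add (f c5) (Nat.add (f c6) (f c7))))))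

theorem sum7_eq (f : K8 → ℕ) :
    sum7 f = f c1 + (f c2 + (f c3 + (f c4 + (f c5 + (f c6 + f c7))))) := rfl

theorem sum7_scale (f : K8 → ℕ) (s : K8) (hs : s ≠ 0) :
    sum7 (fun x => f (s * x)) = sum7 f := by
  simp only [← mul_def, sum7_eq]
  cases s
  · exact absurd rfl hs
  all_goals (simp only [mul, sel]; try omega)

theorem sum7_congr {f g : K8 → ℕ} (h : ∀ x, x ≠ 0 → f x = g x) : sum7 f = sum7 g := by
  simp only [sum7_eq]
  rw [h c1 (by intro h; cases h), h c2 (by intro h; cases h), h c3 (by intro h; cases h),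
    h c4 (by intro h; cases h), h c5 (by intro h; cases h), h c6 (by intro h; cases h),
    h c7 (by intro h; cases h)]

theorem sum7_le {f : K8 → ℕ} {n : ℕ} (h : ∀ x, f x ≤ n) : sum7 f ≤ 7 * n := by
  have h1 := h c1
  have h2 := h c2
  have h3 := h c3
  have h4 := h c4
  have h5 := h c5
  have h6 := h c6
  have h7 := h c7
  rw [sum7_eq]; omega

/-- Indicator of zero. -/
noncomputable def iz (v : K8) : ℕ := sel 1 0 0 0 0 0 0 0 v

theorem iz_eq (v : K8) : iz v = if v = 0 then 1 else 0 := by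
  cases v <;> rfl

theorem iz_le (v : K8) : iz v ≤ 1 := by
  rw [iz_eq]; split <;> omega

/-! ### Forcing evaluation -/

noncomputable def forceK {R : Type} (v : K8) (k : K8 → R) : R :=
  sel (k c0) (k c1) (k c2) (k c3) (k c4) (k c5) (k c6) (k c7) v

theorem forceK_eq {R : Type} (v : K8) (k : K8 → R) : forceK v k = k v := by
  cases v <;> rfl

noncomputable def forceN {R : Type} (v : ℕ) (k : ℕ → R) : R :=
  @Nat.rec (fun _ => R) (k 0) (fun m _ => k (Nat.succ m)) v

theorem forceN_eq {R : Type} (v : ℕ) (k : ℕ → R) : forceN v k = k v := by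
  cases v <;> rfl

noncomputable def force8 {α R : Type} (F : α → (α → R) → R) (f : K8 → α) (k : (K8 → α) → R) : R :=
  F (f c0) fun a0 => F (f c1) fun a1 => F (f c2) fun a2 => F (f c3) fun a3 =>
  F (f c4) fun a4 => F (f c5) fun a5 => F (f c6) fun a6 => F (f c7) fun a7 =>
    k (sel a0 a1 a2 a3 a4 a5 a6 a7)

theorem force8_eq {α R : Type} (F : α → (α → R) → R) (hF : ∀ a k, F a k = k a)
    (f : K8 → α) (k : (K8 → α) → R) : force8 F f k = k f := by
  simp only [force8, hF]
  congr 1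
  funext v
  cases v <;> rfl

/-! ### Packed vectors of counters -/

noncomputable def enc8 (w : ℕ) (f : K8 → ℕ) : ℕ :=
  Nat.add (f c0) (Nat.mul (Nat.pow 2 w) (Nat.add (f c1) (Nat.mul (Nat.pow 2 w)
  (Nat.add (f c2) (Nat.mul (Nat.pow 2 w) (Nat.add (f c3) (Nat.mul (Nat.pow 2 w)
  (Nat.add (f c4) (Nat.mul (Nat.pow 2 w) (Nat.add (f c5) (Nat.mul (Nat.pow 2 w)
  (Nat.add (f c6) (Nat.mul (Nat.pow 2 w) (f c7))))))))))))))

theorem enc8_eq (w : ℕ) (f : K8 → ℕ) :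
    enc8 w f = f c0 + 2 ^ w * (f c1 + 2 ^ w * (f c2 + 2 ^ w * (f c3 + 2 ^ w * (f c4 +
      2 ^ w * (f c5 + 2 ^ w * (f c6 + 2 ^ w * f c7)))))) := rfl

theorem enc8_add (w : ℕ) (f g : K8 → ℕ) :
    enc8 w f + enc8 w g = enc8 w (fun u => f u + g u) := by
  simp only [enc8_eq]; ring

theorem enc8_sum7 (w : ℕ) (f : K8 → K8 → ℕ) :
    sum7 (fun x => enc8 w (f x)) = enc8 w (fun u => sum7 (fun x => f x u)) := by
  simp only [sum7_eq, enc8_add]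

theorem land_step (w a b x y : ℕ) (ha : a < 2 ^ w) (hb : b < 2 ^ w) :
    Nat.land (a + 2 ^ w * x) (b + 2 ^ w * y) = Nat.land a b + 2 ^ w * Nat.land x y := by
  change (a + 2 ^ w * x) &&& (b + 2 ^ w * y) = (a &&& b) + 2 ^ w * (x &&& y)
  have h1 := Nat.and_mod_two_pow (a := a + 2 ^ w * x) (b := b + 2 ^ w * y) (n := w)
  have h2 := Nat.and_div_two_pow (a := a + 2 ^ w * x) (b := b + 2 ^ w * y) (n := w)
  have hp : 0 < 2 ^ w := Nat.two_pow_pos w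
  rw [Nat.add_mul_mod_self_left, Nat.add_mul_mod_self_left, Nat.mod_eq_of_lt ha,
    Nat.mod_eq_of_lt hb] at h1
  rw [Nat.add_mul_div_left _ _ hp, Nat.add_mul_div_left _ _ hp, Nat.div_eq_of_lt ha,
    Nat.div_eq_of_lt hb, Nat.zero_add, Nat.zero_add] at h2
  rw [← h1, ← h2]
  exact (Nat.mod_add_div _ _).symm

theorem enc8_land (w : ℕ) (f g : K8 → ℕ) (hf : ∀ u, f u < 2 ^ w) (hg : ∀ u, g u < 2 ^ w) :
    Nat.land (enc8 w f) (enc8 w g) = enc8 w (fun u => Nat.land (f u) (g u)) := by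
  simp only [enc8_eq]
  rw [land_step w _ _ _ _ (hf _) (hg _), land_step w _ _ _ _ (hf _) (hg _),
    land_step w _ _ _ _ (hf _) (hg _), land_step w _ _ _ _ (hf _) (hg _),
    land_step w _ _ _ _ (hf _) (hg _), land_step w _ _ _ _ (hf _) (hg _),
    land_step w _ _ _ _ (hf _) (hg _)]

theorem enc8_zero (w : ℕ) (f : K8 → ℕ) (h : enc8 w f = 0) (u : K8) : f u = 0 := by
  have hp : 2 ^ w ≠ 0 := (Nat.two_pow_pos w).ne'
  simp only [enc8_eq, Nat.add_eq_zero_iff, mul_eq_zero, hp, false_or] at h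
  cases u <;> tauto

theorem lt_step (w m a x : ℕ) (ha : a < 2 ^ w) (hx : x < 2 ^ m) :
    a + 2 ^ w * x < 2 ^ (w + m) := by
  rw [pow_add]
  calc a + 2 ^ w * x < 2 ^ w + 2 ^ w * x := by omega
    _ = 2 ^ w * (x + 1) := by ring
    _ ≤ 2 ^ w * 2 ^ m := Nat.mul_le_mul_left _ hx

theorem enc8_lt (w : ℕ) (f : K8 → ℕ) (hf : ∀ u, f u < 2 ^ w) : enc8 w f < 2 ^ (8 * w) := by
  have e : 8 * w = w + (w + (w + (w + (w + (w + (w + w)))))) := by ring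
  rw [e, enc8_eq]
  exact lt_step _ _ _ _ (hf _) (lt_step _ _ _ _ (hf _) (lt_step _ _ _ _ (hf _)
    (lt_step _ _ _ _ (hf _) (lt_step _ _ _ _ (hf _) (lt_step _ _ _ _ (hf _)
    (lt_step _ _ _ _ (hf _) (hf _)))))))

noncomputable def enc3 (f : K8 → K8 → K8 → ℕ) : ℕ :=
  enc8 512 fun u4 => enc8 64 fun u2 => enc8 8 fun u0 => f u0 u2 u4

theorem enc3_add (f g : K8 → K8 → K8 → ℕ) :
    enc3 f + enc3 g = enc3 (fun u0 u2 u4 => f u0 u2 u4 + g u0 u2 u4) := by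
  simp only [enc3, enc8_add]

theorem enc3_sum7 (f : K8 → K8 → K8 → K8 → ℕ) :
    sum7 (fun x => enc3 (f x)) = enc3 (fun u0 u2 u4 => sum7 (fun x => f x u0 u2 u4)) := by
  simp only [enc3, enc8_sum7]

set_option exponentiation.threshold 600 in
theorem enc3_land_zero (f g : K8 → K8 → K8 → ℕ) (hf : ∀ u v w, f u v w < 256)
    (hg : ∀ u v w, g u v w < 256) (h : Nat.land (enc3 f) (enc3 g) = 0) (u0 u2 u4 : K8) :
    Nat.land (f u0 u2 u4) (g u0 u2 u4) = 0 := by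
  have hf1 : ∀ u4 u2, enc8 8 (fun u0 => f u0 u2 u4) < 2 ^ 64 := fun u4 u2 =>
    enc8_lt 8 _ (fun u => hf u _ _)
  have hg1 : ∀ u4 u2, enc8 8 (fun u0 => g u0 u2 u4) < 2 ^ 64 := fun u4 u2 =>
    enc8_lt 8 _ (fun u => hg u _ _)
  have hf2 : ∀ u4, enc8 64 (fun u2 => enc8 8 (fun u0 => f u0 u2 u4)) < 2 ^ 512 := fun u4 =>
    enc8_lt 64 _ (fun u => hf1 u4 u)
  have hg2 : ∀ u4, enc8 64 (fun u2 => enc8 8 (fun u0 => g u0 u2 u4)) < 2 ^ 512 := fun u4 =>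
    enc8_lt 64 _ (fun u => hg1 u4 u)
  unfold enc3 at h
  rw [enc8_land 512 _ _ hf2 hg2] at h
  have h1 := enc8_zero _ _ h u4
  beta_reduce at h1
  rw [enc8_land 64 _ _ (hf1 u4) (hg1 u4)] at h1
  have h2 := enc8_zero _ _ h1 u2
  beta_reduce at h2
  rw [enc8_land 8 _ _ (fun u => hf u u2 u4) (fun u => hg u u2 u4)] at h2
  exact enc8_zero _ _ h2 u0

/-! ### Masks -/

noncomputable def p256 (v : K8) : ℕ :=
  sel 1 256 65536 16777216 4294967296 1099511627776 281474976710656 72057594037927936 v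

noncomputable def m1 (k b : K8) : ℕ :=
  sel (sel 72340172838076673 0 0 0 0 0 0 0 b)
    (p256 (mul c1 b))
    (p256 (mul c5 b))
    (p256 (mul c6 b))
    (p256 (mul c7 b))
    (p256 (mul c2 b))
    (p256 (mul c3 b))
    (p256 (mul c4 b))
    k

theorem m1_eq (k b : K8) : m1 k b = enc8 8 (fun u => iz (add b (mul k u))) := by
  cases k <;> cases b <;> rfl

noncomputable def mask (k0 k2 k4 b : K8) : ℕ :=
  enc8 512 fun u4 => enc8 64 fun u2 => m1 k0 (add b (add (mul k2 u2) (mul k4 u4)))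

theorem mask_eq (k0 k2 k4 b : K8) : mask k0 k2 k4 b =
    enc3 (fun u0 u2 u4 => iz (b + (k2 * u2 + k4 * u4) + k0 * u0)) := by
  simp only [mask, m1_eq]
  rfl

/-! ### Row polynomials -/

structure P5 : Type where
  q0 : K8
  q1 : K8
  q2 : K8
  q3 : K8
  q4 : K8
  deriving DecidableEq

noncomputable def ev (q0 q1 q2 q3 q4 x : K8) : K8 :=
  add q0 (mul x (add q1 (mul x (add q2 (mul x (add q3 (mul x q4)))))))

theorem ev_eq (q0 q1 q2 q3 q4 x : K8) :
    ev q0 q1 q2 q3 q4 x = q0 + q1 * x + q2 * x ^ 2 + q3 * x ^ 3 + q4 * x ^ 4 := by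
  simp only [ev, add_def, mul_def]; ring

noncomputable def zr (p : P5) : ℕ := sum7 fun x => iz (ev p.q0 p.q1 p.q2 p.q3 p.q4 x)

noncomputable def psc (c s : K8) (p : P5) : P5 :=
  ⟨mul c p.q0, mul c (mul s p.q1), mul c (mul s (mul s p.q2)),
    mul c (mul s (mul s (mul s p.q3))), mul c (mul s (mul s (mul s (mul s p.q4))))⟩

noncomputable def kbeq (a b : K8) : Bool :=
  sel (sel true false false false false false false false b)
    (sel false true false false false false false false b)
    (sel false false true false false false false false b)
    (sel false false false true false false false false b)
    (sel false false false false true false false false b)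
    (sel false false false false false true false false b)
    (sel false false false false false false true false b)
    (sel false false false false false false false true b) a

theorem kbeq_eq (a b : K8) (h : kbeq a b = true) : a = b := by
  revert h
  cases a <;> cases b <;> first | (intro _; rfl) | (intro h; cases h)

noncomputable def pbeq (p q : P5) : Bool :=
  kbeq p.q0 q.q0 && (kbeq p.q1 q.q1 && (kbeq p.q2 q.q2 && (kbeq p.q3 q.q3 && kbeq p.q4 q.q4)))

theorem pbeq_eq (p q : P5) (h : pbeq p q = true) : p = q := by
  obtain ⟨a, b, c, d, e⟩ := p
  obtain ⟨a', b', c', d', e'⟩ := q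
  simp only [pbeq, Bool.and_eq_true] at h
  obtain ⟨h1, h2, h3, h4, h5⟩ := h
  rw [kbeq_eq _ _ h1, kbeq_eq _ _ h2, kbeq_eq _ _ h3, kbeq_eq _ _ h4, kbeq_eq _ _ h5]

noncomputable def allB {α : Type} (p : α → Bool) (l : List α) : Bool :=
  @List.rec α (fun _ => Bool) true (fun a _ ih => and (p a) ih) l

theorem allB_mem {α : Type} (p : α → Bool) (l : List α) (h : allB p l = true) :
    ∀ a ∈ l, p a = true := by
  induction l with
  | nil => intro a ha; cases ha
  | cons b l ih =>
    have h' : (p b && allB p l) = true := h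
    rw [Bool.and_eq_true] at h'
    intro a ha
    rcases List.mem_cons.1 ha with rfl | ha
    · exact h'.1
    · exact ih h'.2 a ha

noncomputable def memB (q : P5) (l : List P5) : Bool :=
  @List.rec P5 (fun _ => Bool) false (fun a _ ih => or (pbeq q a) ih) l

theorem memB_mem (q : P5) (l : List P5) (h : memB q l = true) : q ∈ l := by
  induction l with
  | nil => cases h
  | cons b l ih =>
    have h' : (pbeq q b || memB q l) = true := h
    rw [Bool.or_eq_true] at h'
    rcases h' with h' | h'
    · rw [pbeq_eq _ _ h']; exact List.mem_cons_self
    · exact List.mem_cons_of_mem _ (ih h')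

noncomputable def all7 (p : K8 → Bool) : Bool :=
  p c1 && (p c2 && (p c3 && (p c4 && (p c5 && (p c6 && p c7)))))

noncomputable def all8 (p : K8 → Bool) : Bool := p c0 && all7 p

noncomputable def any7 (p : K8 → Bool) : Bool :=
  p c1 || (p c2 || (p c3 || (p c4 || (p c5 || (p c6 || p c7)))))

theorem all7_spec (p : K8 → Bool) (h : all7 p = true) (x : K8) (hx : x ≠ 0) : p x = true := by
  simp only [all7, Bool.and_eq_true] at h
  cases x
  · exact absurd rfl hx
  all_goals tauto

theorem all8_spec (p : K8 → Bool) (h : all8 p = true) (x : K8) : p x = true := by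
  simp only [all8, all7, Bool.and_eq_true] at h
  cases x <;> tauto

theorem any7_spec (p : K8 → Bool) (h : any7 p = true) : ∃ x, x ≠ 0 ∧ p x = true := by
  simp only [any7, Bool.or_eq_true] at h
  rcases h with h | h | h | h | h | h | h
  · exact ⟨c1, by decide, h⟩
  · exact ⟨c2, by decide, h⟩
  · exact ⟨c3, by decide, h⟩
  · exact ⟨c4, by decide, h⟩
  · exact ⟨c5, by decide, h⟩
  · exact ⟨c6, by decide, h⟩
  · exact ⟨c7, by decide, h⟩

/-- Representatives, up to scaling, of the monic quartics with four distinct nonzero roots. -/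
def L5 : List P5 := [
  ⟨c1,c0,c1,c1,c1⟩, ⟨c1,c1,c1,c0,c1⟩, ⟨c1,c2,c6,c2,c1⟩, ⟨c1,c4,c2,c4,c1⟩, ⟨c1,c6,c4,c6,c1⟩]

/-- Monic quartics with four distinct nonzero roots. -/
def L35 : List P5 := [
  ⟨c1,c0,c1,c1,c1⟩, ⟨c1,c1,c1,c0,c1⟩, ⟨c1,c2,c6,c2,c1⟩, ⟨c1,c4,c2,c4,c1⟩, ⟨c1,c6,c4,c6,c1⟩,
  ⟨c2,c0,c6,c4,c1⟩, ⟨c2,c1,c2,c3,c1⟩, ⟨c2,c2,c7,c6,c1⟩, ⟨c2,c3,c5,c5,c1⟩, ⟨c2,c5,c6,c0,c1⟩,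
  ⟨c3,c0,c7,c5,c1⟩, ⟨c3,c2,c1,c3,c1⟩, ⟨c3,c5,c5,c2,c1⟩, ⟨c3,c6,c7,c0,c1⟩, ⟨c3,c7,c4,c1,c1⟩,
  ⟨c4,c0,c2,c6,c1⟩, ⟨c4,c1,c4,c5,c1⟩, ⟨c4,c4,c3,c2,c1⟩, ⟨c4,c5,c7,c7,c1⟩, ⟨c4,c7,c2,c0,c1⟩,
  ⟨c5,c0,c3,c7,c1⟩, ⟨c5,c2,c3,c0,c1⟩, ⟨c5,c3,c6,c1,c1⟩, ⟨c5,c4,c1,c5,c1⟩, ⟨c5,c7,c7,c4,c1⟩,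
  ⟨c6,c0,c4,c2,c1⟩, ⟨c6,c1,c6,c7,c1⟩, ⟨c6,c3,c4,c0,c1⟩, ⟨c6,c6,c5,c4,c1⟩, ⟨c6,c7,c3,c3,c1⟩,
  ⟨c7,c0,c5,c3,c1⟩, ⟨c7,c3,c3,c6,c1⟩, ⟨c7,c4,c5,c0,c1⟩, ⟨c7,c5,c2,c1,c1⟩, ⟨c7,c6,c1,c7,c1⟩]

/-- Monic polynomials of degree at most four with at least three nonzero roots. -/
def L210 : List P5 := [
  ⟨c0,c1,c0,c1,c1⟩, ⟨c0,c1,c1,c0,c1⟩, ⟨c0,c1,c2,c2,c1⟩, ⟨c0,c1,c4,c4,c1⟩, ⟨c0,c1,c6,c6,c1⟩,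
  ⟨c0,c2,c0,c7,c1⟩, ⟨c0,c2,c1,c4,c1⟩, ⟨c0,c2,c3,c0,c1⟩, ⟨c0,c2,c6,c5,c1⟩, ⟨c0,c2,c7,c1,c1⟩,
  ⟨c0,c3,c0,c2,c1⟩, ⟨c0,c3,c3,c4,c1⟩, ⟨c0,c3,c4,c0,c1⟩, ⟨c0,c3,c5,c7,c1⟩, ⟨c0,c3,c6,c3,c1⟩,
  ⟨c0,c4,c0,c3,c1⟩, ⟨c0,c4,c1,c6,c1⟩, ⟨c0,c4,c2,c7,c1⟩, ⟨c0,c4,c3,c1,c1⟩, ⟨c0,c4,c5,c0,c1⟩,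
  ⟨c0,c5,c0,c4,c1⟩, ⟨c0,c5,c2,c5,c1⟩, ⟨c0,c5,c5,c6,c1⟩, ⟨c0,c5,c6,c0,c1⟩, ⟨c0,c5,c7,c3,c1⟩,
  ⟨c0,c6,c0,c5,c1⟩, ⟨c0,c6,c1,c2,c1⟩, ⟨c0,c6,c4,c3,c1⟩, ⟨c0,c6,c5,c1,c1⟩, ⟨c0,c6,c7,c0,c1⟩,
  ⟨c0,c7,c0,c6,c1⟩, ⟨c0,c7,c2,c0,c1⟩, ⟨c0,c7,c3,c5,c1⟩, ⟨c0,c7,c4,c7,c1⟩, ⟨c0,c7,c7,c2,c1⟩,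
  ⟨c1,c0,c1,c1,c0⟩, ⟨c1,c0,c1,c1,c1⟩, ⟨c1,c1,c0,c1,c0⟩, ⟨c1,c1,c1,c0,c1⟩, ⟨c1,c1,c3,c7,c1⟩,
  ⟨c1,c1,c5,c3,c1⟩, ⟨c1,c1,c7,c5,c1⟩, ⟨c1,c2,c2,c1,c0⟩, ⟨c1,c2,c5,c7,c1⟩, ⟨c1,c2,c6,c2,c1⟩,
  ⟨c1,c3,c0,c3,c1⟩, ⟨c1,c3,c5,c1,c1⟩, ⟨c1,c3,c7,c4,c1⟩, ⟨c1,c4,c2,c4,c1⟩, ⟨c1,c4,c4,c1,c0⟩,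
  ⟨c1,c4,c7,c3,c1⟩, ⟨c1,c5,c0,c5,c1⟩, ⟨c1,c5,c3,c6,c1⟩, ⟨c1,c5,c7,c1,c1⟩, ⟨c1,c6,c3,c5,c1⟩,
  ⟨c1,c6,c4,c6,c1⟩, ⟨c1,c6,c6,c1,c0⟩, ⟨c1,c7,c0,c7,c1⟩, ⟨c1,c7,c3,c1,c1⟩, ⟨c1,c7,c5,c2,c1⟩,
  ⟨c2,c0,c6,c4,c1⟩, ⟨c2,c0,c7,c1,c0⟩, ⟨c2,c1,c2,c3,c1⟩, ⟨c2,c1,c3,c1,c1⟩, ⟨c2,c1,c4,c1,c0⟩,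
  ⟨c2,c2,c4,c7,c1⟩, ⟨c2,c2,c7,c6,c1⟩, ⟨c2,c3,c0,c1,c0⟩, ⟨c2,c3,c1,c2,c1⟩, ⟨c2,c3,c5,c5,c1⟩,
  ⟨c2,c4,c0,c7,c1⟩, ⟨c2,c4,c3,c4,c1⟩, ⟨c2,c4,c4,c6,c1⟩, ⟨c2,c5,c1,c1,c1⟩, ⟨c2,c5,c3,c7,c1⟩,
  ⟨c2,c5,c4,c2,c1⟩, ⟨c2,c5,c6,c0,c1⟩, ⟨c2,c6,c0,c1,c1⟩, ⟨c2,c6,c1,c4,c1⟩, ⟨c2,c6,c3,c3,c1⟩,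
  ⟨c2,c6,c5,c1,c0⟩, ⟨c2,c7,c0,c2,c1⟩, ⟨c2,c7,c1,c1,c0⟩, ⟨c2,c7,c1,c5,c1⟩, ⟨c2,c7,c4,c4,c1⟩,
  ⟨c3,c0,c2,c1,c0⟩, ⟨c3,c0,c7,c5,c1⟩, ⟨c3,c1,c0,c4,c1⟩, ⟨c3,c1,c3,c2,c1⟩, ⟨c3,c1,c6,c5,c1⟩,
  ⟨c3,c2,c1,c3,c1⟩, ⟨c3,c2,c2,c7,c1⟩, ⟨c3,c3,c0,c7,c1⟩, ⟨c3,c3,c2,c3,c1⟩, ⟨c3,c3,c3,c5,c1⟩,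
  ⟨c3,c3,c4,c1,c0⟩, ⟨c3,c4,c0,c1,c0⟩, ⟨c3,c4,c0,c6,c1⟩, ⟨c3,c4,c2,c5,c1⟩, ⟨c3,c4,c6,c1,c1⟩,
  ⟨c3,c5,c3,c4,c1⟩, ⟨c3,c5,c5,c2,c1⟩, ⟨c3,c5,c7,c1,c0⟩, ⟨c3,c6,c2,c6,c1⟩, ⟨c3,c6,c3,c1,c0⟩,
  ⟨c3,c6,c3,c7,c1⟩, ⟨c3,c6,c6,c4,c1⟩, ⟨c3,c6,c7,c0,c1⟩, ⟨c3,c7,c4,c1,c1⟩, ⟨c3,c7,c6,c6,c1⟩,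
  ⟨c4,c0,c2,c6,c1⟩, ⟨c4,c0,c3,c1,c0⟩, ⟨c4,c1,c4,c5,c1⟩, ⟨c4,c1,c5,c1,c1⟩, ⟨c4,c1,c6,c1,c0⟩,
  ⟨c4,c2,c0,c1,c1⟩, ⟨c4,c2,c1,c6,c1⟩, ⟨c4,c2,c5,c5,c1⟩, ⟨c4,c2,c7,c1,c0⟩, ⟨c4,c3,c0,c4,c1⟩,
  ⟨c4,c3,c1,c1,c0⟩, ⟨c4,c3,c1,c7,c1⟩, ⟨c4,c3,c6,c6,c1⟩, ⟨c4,c4,c3,c2,c1⟩, ⟨c4,c4,c6,c3,c1⟩,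
  ⟨c4,c5,c0,c1,c0⟩, ⟨c4,c5,c1,c4,c1⟩, ⟨c4,c5,c7,c7,c1⟩, ⟨c4,c6,c0,c3,c1⟩, ⟨c4,c6,c5,c6,c1⟩,
  ⟨c4,c6,c6,c2,c1⟩, ⟨c4,c7,c1,c1,c1⟩, ⟨c4,c7,c2,c0,c1⟩, ⟨c4,c7,c5,c3,c1⟩, ⟨c4,c7,c6,c4,c1⟩,
  ⟨c5,c0,c3,c7,c1⟩, ⟨c5,c0,c4,c1,c0⟩, ⟨c5,c1,c0,c6,c1⟩, ⟨c5,c1,c2,c7,c1⟩, ⟨c5,c1,c5,c4,c1⟩,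
  ⟨c5,c2,c2,c6,c1⟩, ⟨c5,c2,c3,c0,c1⟩, ⟨c5,c2,c4,c2,c1⟩, ⟨c5,c2,c5,c1,c0⟩, ⟨c5,c2,c5,c3,c1⟩,
  ⟨c5,c3,c2,c2,c1⟩, ⟨c5,c3,c6,c1,c1⟩, ⟨c5,c4,c1,c5,c1⟩, ⟨c5,c4,c4,c3,c1⟩, ⟨c5,c5,c0,c3,c1⟩,
  ⟨c5,c5,c4,c5,c1⟩, ⟨c5,c5,c5,c7,c1⟩, ⟨c5,c5,c6,c1,c0⟩, ⟨c5,c6,c0,c1,c0⟩, ⟨c5,c6,c0,c2,c1⟩,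
  ⟨c5,c6,c2,c1,c1⟩, ⟨c5,c6,c4,c7,c1⟩, ⟨c5,c7,c3,c1,c0⟩, ⟨c5,c7,c5,c6,c1⟩, ⟨c5,c7,c7,c4,c1⟩,
  ⟨c6,c0,c4,c2,c1⟩, ⟨c6,c0,c5,c1,c0⟩, ⟨c6,c1,c2,c1,c0⟩, ⟨c6,c1,c6,c7,c1⟩, ⟨c6,c1,c7,c1,c1⟩,
  ⟨c6,c2,c0,c5,c1⟩, ⟨c6,c2,c2,c4,c1⟩, ⟨c6,c2,c7,c2,c1⟩, ⟨c6,c3,c1,c1,c1⟩, ⟨c6,c3,c2,c6,c1⟩,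
  ⟨c6,c3,c4,c0,c1⟩, ⟨c6,c3,c7,c5,c1⟩, ⟨c6,c4,c0,c1,c1⟩, ⟨c6,c4,c1,c2,c1⟩, ⟨c6,c4,c3,c1,c0⟩,
  ⟨c6,c4,c7,c7,c1⟩, ⟨c6,c5,c0,c6,c1⟩, ⟨c6,c5,c1,c1,c0⟩, ⟨c6,c5,c1,c3,c1⟩, ⟨c6,c5,c2,c2,c1⟩,
  ⟨c6,c6,c2,c5,c1⟩, ⟨c6,c6,c5,c4,c1⟩, ⟨c6,c7,c0,c1,c0⟩, ⟨c6,c7,c1,c6,c1⟩, ⟨c6,c7,c3,c3,c1⟩,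
  ⟨c7,c0,c5,c3,c1⟩, ⟨c7,c0,c6,c1,c0⟩, ⟨c7,c1,c0,c2,c1⟩, ⟨c7,c1,c4,c3,c1⟩, ⟨c7,c1,c7,c6,c1⟩,
  ⟨c7,c2,c0,c1,c0⟩, ⟨c7,c2,c0,c4,c1⟩, ⟨c7,c2,c4,c1,c1⟩, ⟨c7,c2,c6,c3,c1⟩, ⟨c7,c3,c3,c6,c1⟩,
  ⟨c7,c3,c5,c1,c0⟩, ⟨c7,c3,c7,c2,c1⟩, ⟨c7,c4,c4,c2,c1⟩, ⟨c7,c4,c5,c0,c1⟩, ⟨c7,c4,c6,c4,c1⟩,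
  ⟨c7,c4,c7,c1,c0⟩, ⟨c7,c4,c7,c5,c1⟩, ⟨c7,c5,c2,c1,c1⟩, ⟨c7,c5,c4,c4,c1⟩, ⟨c7,c6,c1,c7,c1⟩,
  ⟨c7,c6,c6,c5,c1⟩, ⟨c7,c7,c0,c5,c1⟩, ⟨c7,c7,c2,c1,c0⟩, ⟨c7,c7,c6,c7,c1⟩, ⟨c7,c7,c7,c3,c1⟩]

noncomputable def rowOK (p : P5) : Bool :=
  forceN (zr p) fun n =>
    Nat.ble n 2 || (memB p L210 && (Nat.beq n 3 || (Nat.beq n 4 && memB p L35)))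

noncomputable def rowCheck : Bool :=
  (all8 fun a => all8 fun b => all8 fun c => all8 fun d => rowOK ⟨a, b, c, d, c1⟩) &&
  ((all8 fun a => all8 fun b => all8 fun c => rowOK ⟨a, b, c, c1, c0⟩) &&
  ((all8 fun a => all8 fun b => rowOK ⟨a, b, c1, c0, c0⟩) &&
  ((all8 fun a => rowOK ⟨a, c1, c0, c0, c0⟩) && rowOK ⟨c1, c0, c0, c0, c0⟩)))

theorem rowCheck_true : rowCheck = true := by decide +kernel

noncomputable def repCheck : Bool :=
  allB (fun p => any7 fun s => any7 fun c => memB (psc c s p) L5) L35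

theorem repCheck_true : repCheck = true := by decide +kernel

/-! ### The packed check -/

noncomputable def lam0 (t y : K8) : K8 := mul (mul (mul y y) (add y t)) (inv (add c1 t))
noncomputable def mu0 (t y : K8) : K8 :=
  mul (mul (mul y y) (add y c1)) (inv (mul (mul t t) (add c1 t)))
noncomputable def lam1 (t y : K8) : K8 := mul (add (mul y y) (mul t t)) (inv (add c1 (mul t t)))
noncomputable def mu1 (t y : K8) : K8 := mul (add (mul y y) c1) (inv (add c1 (mul t t)))
noncomputable def lam2 (t y : K8) : K8 := mul (mul y (add y t)) (inv (add c1 t))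
noncomputable def mu2 (t y : K8) : K8 := mul (mul y (add y c1)) (inv (mul t (add c1 t)))
noncomputable def lam4 (t y : K8) : K8 :=
  mul (mul y (add (mul y y) (mul t t))) (inv (add c1 (mul t t)))
noncomputable def mu4 (t y : K8) : K8 :=
  mul (mul y (add (mul y y) c1)) (inv (mul t (add c1 (mul t t))))

noncomputable def p4 (y : K8) : K8 := mul (mul y y) (mul y y)

noncomputable def H0 (t y : K8) : K8 := add (p4 y) (add (lam0 t y) (mul (mu0 t y) (p4 t)))
noncomputable def H2 (t y : K8) : K8 := add (p4 y) (add (lam2 t y) (mul (mu2 t y) (p4 t)))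
noncomputable def H4 (t y : K8) : K8 := add (p4 y) (add (lam4 t y) (mul (mu4 t y) (p4 t)))

noncomputable def tab (t y x : K8) (b : K8) : ℕ :=
  forceK (H0 t y) fun k0 => forceK (mul (H2 t y) (mul x x)) fun k2 =>
  forceK (mul (H4 t y) (p4 x)) fun k4 => mask k0 k2 k4 b

/-- Evaluate a table at the nonzero field elements, using the evaluator `F`. -/
noncomputable def build7 {α R : Type} (f : K8 → α) (F : K8 → (α → R) → R) (k : (K8 → α) → R) : R :=
  F c1 fun a1 => F c2 fun a2 => F c3 fun a3 =>
  F c4 fun a4 => F c5 fun a5 => F c6 fun a6 => F c7 fun a7 =>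
    k (sel (f c0) a1 a2 a3 a4 a5 a6 a7)

theorem build7_eq {α R : Type} (f : K8 → α) (F : K8 → (α → R) → R)
    (hF : ∀ v k, F v k = k (f v)) (k : (K8 → α) → R) : build7 f F k = k f := by
  simp only [build7, hF]
  congr 1
  funext v
  cases v <;> rfl

noncomputable def bmask {R : Type} (t y x : K8) (k : (K8 → ℕ) → R) : R :=
  forceK (H0 t y) fun k0 => forceK (mul (H2 t y) (mul x x)) fun k2 =>
  forceK (mul (H4 t y) (p4 x)) fun k4 =>
  force8 forceN (fun b => enc8 64 fun u2 => m1 k0 (add b (mul k2 u2))) fun g =>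
  force8 forceN (fun b => enc8 512 fun u4 => g (add b (mul k4 u4))) k

theorem bmask_eq {R : Type} (t y x : K8) (k : (K8 → ℕ) → R) : bmask t y x k = k (tab t y x) := by
  simp only [bmask, forceK_eq]
  rw [force8_eq _ forceN_eq, force8_eq _ forceN_eq]
  refine congrArg k (funext fun b => ?_)
  simp only [tab, forceK_eq, mask, add_def]
  refine congrArg (enc8 512) (funext fun u4 => congrArg (enc8 64) (funext fun u2 => ?_))
  refine congrArg (m1 (H0 t y)) ?_
  ring

noncomputable def btab {R : Type} (t : K8) (k : (K8 → K8 → K8 → ℕ) → R) : R :=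
  build7 (tab t) (fun y => build7 (tab t y) (fun x => bmask t y x)) k

theorem btab_eq {R : Type} (t : K8) (k : (K8 → K8 → K8 → ℕ) → R) : btab t k = k (tab t) :=
  build7_eq _ _ (fun y k => build7_eq _ _ (fun x k => bmask_eq t y x k) k) k

noncomputable def rowSum (T : K8 → K8 → ℕ) (r0 r1 r2 r3 r4 : K8) : ℕ :=
  sum7 fun x => T x (ev r0 r1 r2 r3 r4 x)

noncomputable def totSum (T : K8 → K8 → K8 → ℕ) (l0 n0 l1 n1 l2 n2 l4 n4 : K8 → K8) (P Q : P5) : ℕ :=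
  sum7 fun y =>
    forceK (add (mul (l0 y) P.q0) (mul (n0 y) Q.q0)) fun r0 =>
    forceK (add (mul (l1 y) P.q1) (mul (n1 y) Q.q1)) fun r1 =>
    forceK (add (mul (l2 y) P.q2) (mul (n2 y) Q.q2)) fun r2 =>
    forceK (add (mul (l1 y) P.q3) (mul (n1 y) Q.q3)) fun r3 =>
    forceK (add (mul (l4 y) P.q4) (mul (n4 y) Q.q4)) fun r4 =>
    rowSum (T y) r0 r1 r2 r3 r4

noncomputable def test (bi hi n : ℕ) : Bool := Nat.beq (Nat.land (Nat.add n bi) hi) 0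

noncomputable def bias : ℕ := enc3 fun _ _ _ => 105
noncomputable def hiA : ℕ := enc3 fun _ _ _ => 128
noncomputable def psiC (u0 u2 u4 : K8) : ℕ :=
  sel (sel (sel 0 128 128 128 128 128 128 128 u0) 128 128 128 128 128 128 128 u2)
    128 128 128 128 128 128 128 u4
noncomputable def hiC : ℕ := enc3 psiC

def pz : P5 := ⟨c0, c0, c0, c0, c0⟩

noncomputable def loop (bi hA hC : ℕ) (f : P5 → P5 → ℕ) : Bool :=
  test bi hC (f pz pz) &&
  (allB (fun Q => test bi hA (f pz Q)) L210 &&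
  allB (fun Q => all7 fun c => allB (fun P => test bi hA (f P (psc c c1 Q))) L5) L35)

noncomputable def chk (t : K8) : Bool :=
  forceN bias fun bi => forceN hiA fun hA => forceN hiC fun hC =>
  force8 forceK (lam0 t) fun l0 => force8 forceK (mu0 t) fun n0 =>
  force8 forceK (lam1 t) fun l1 => force8 forceK (mu1 t) fun n1 =>
  force8 forceK (lam2 t) fun l2 => force8 forceK (mu2 t) fun n2 =>
  force8 forceK (lam4 t) fun l4 => force8 forceK (mu4 t) fun n4 =>
  btab t fun T =>
  loop bi hA hC (totSum T l0 n0 l1 n1 l2 n2 l4 n4)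

theorem chk2 : chk c2 = true := by decide +kernel
theorem chk3 : chk c3 = true := by decide +kernel
theorem chk4 : chk c4 = true := by decide +kernel
theorem chk5 : chk c5 = true := by decide +kernel
theorem chk6 : chk c6 = true := by decide +kernel
theorem chk7 : chk c7 = true := by decide +kernel

theorem chk_all (t : K8) (h0 : t ≠ 0) (h1 : t ≠ 1) : chk t = true := by
  cases t
  · exact absurd rfl h0
  · exact absurd rfl h1
  · exact chk2
  · exact chk3
  · exact chk4
  · exact chk5
  · exact chk6
  · exact chk7

theorem chk_loop (t : K8) (h : chk t = true) : loop bias hiA hiC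
    (totSum (tab t) (lam0 t) (mu0 t) (lam1 t) (mu1 t) (lam2 t) (mu2 t) (lam4 t) (mu4 t)) = true := by
  unfold chk at h
  simp only [forceN_eq] at h
  simp only [force8_eq (R := Bool) forceK forceK_eq] at h
  rw [btab_eq] at h
  exact h

/-! ### Codewords -/

structure Cf : Type where
  a2 : K8
  a3 : K8
  a4 : K8
  b0 : K8
  b2 : K8
  d1 : K8
  d2 : K8
  d4 : K8
  e0 : K8
  e2 : K8
  f1 : K8
  f3 : K8
  f4 : K8

noncomputable def row (w : Cf) (y : K8) : P5 :=
  ⟨w.a2 * y ^ 2 + w.a3 * y ^ 3 + w.a4 * y ^ 4, w.b0 + w.b2 * y ^ 2,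
    w.d1 * y + w.d2 * y ^ 2 + w.d4 * y ^ 4, w.e0 + w.e2 * y ^ 2,
    w.f1 * y + w.f3 * y ^ 3 + w.f4 * y ^ 4⟩

noncomputable def Zt (w : Cf) : ℕ := sum7 fun y => zr (row w y)

theorem interp (t y : K8) (h0 : t ≠ 0) (h1 : t ≠ 1) :
    (y ^ 2 = lam0 t y + mu0 t y * t ^ 2 ∧ y ^ 3 = lam0 t y + mu0 t y * t ^ 3 ∧
      y ^ 4 = lam0 t y + mu0 t y * t ^ 4 + H0 t y) ∧
    (1 = lam1 t y + mu1 t y ∧ y ^ 2 = lam1 t y + mu1 t y * t ^ 2) ∧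
    (y = lam2 t y + mu2 t y * t ∧ y ^ 2 = lam2 t y + mu2 t y * t ^ 2 ∧
      y ^ 4 = lam2 t y + mu2 t y * t ^ 4 + H2 t y) ∧
    (y = lam4 t y + mu4 t y * t ∧ y ^ 3 = lam4 t y + mu4 t y * t ^ 3 ∧
      y ^ 4 = lam4 t y + mu4 t y * t ^ 4 + H4 t y) := by
  have e2 : ∀ z : K8, z ^ 2 = mul z z := fun z => by rw [mul_def]; ring
  have e3 : ∀ z : K8, z ^ 3 = mul z (mul z z) := fun z => by simp only [mul_def]; ring
  have e4 : ∀ z : K8, z ^ 4 = p4 z := fun z => by simp only [p4, mul_def]; ring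
  simp only [e2, e3, e4, ← mul_def, ← add_def, ← one_def]
  cases t
  · exact absurd rfl h0
  · exact absurd rfl h1
  all_goals cases y <;> decide +kernel

theorem tot_eq (w : Cf) (t : K8) :
    totSum (tab t) (lam0 t) (mu0 t) (lam1 t) (mu1 t) (lam2 t) (mu2 t) (lam4 t) (mu4 t)
      (row w 1) (row w t) + bias =
    enc3 (fun u0 u2 u4 => (sum7 fun y => sum7 fun x =>
      iz (ev (lam0 t y * (row w 1).q0 + mu0 t y * (row w t).q0)
        (lam1 t y * (row w 1).q1 + mu1 t y * (row w t).q1)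
        (lam2 t y * (row w 1).q2 + mu2 t y * (row w t).q2)
        (lam1 t y * (row w 1).q3 + mu1 t y * (row w t).q3)
        (lam4 t y * (row w 1).q4 + mu4 t y * (row w t).q4) x
        + (H2 t y * (x * x) * u2 + H4 t y * p4 x * u4) + H0 t y * u0)) + 105) := by
  simp only [totSum, rowSum, forceK_eq, tab, mask_eq, enc3_sum7, bias, enc3_add, add_def, mul_def]

theorem tot_sound (w : Cf) (t : K8) (h0 : t ≠ 0) (h1 : t ≠ 1) (psi : K8 → K8 → K8 → ℕ)
    (hpsi : ∀ u v z, psi u v z < 256)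
    (h : test bias (enc3 psi)
      (totSum (tab t) (lam0 t) (mu0 t) (lam1 t) (mu1 t) (lam2 t) (mu2 t) (lam4 t) (mu4 t)
      (row w 1) (row w t)) = true) (hu : psi w.a4 w.d4 w.f4 = 128) : Zt w ≤ 22 := by
  have h' := Nat.eq_of_beq_eq_true h
  have h'' : Nat.land (totSum (tab t) (lam0 t) (mu0 t) (lam1 t) (mu1 t) (lam2 t) (mu2 t) (lam4 t)
    (mu4 t) (row w 1) (row w t) + bias) (enc3 psi) = 0 := h'
  rw [tot_eq w t] at h''
  have h3 := enc3_land_zero _ _ (fun u0 u2 u4 => by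
    refine Nat.lt_of_le_of_lt (Nat.add_le_add_right (sum7_le (n := 7) fun y =>
      sum7_le (n := 1) fun x => iz_le _) 105) (by norm_num)) hpsi h'' w.a4 w.d4 w.f4
  beta_reduce at h3
  rw [hu] at h3
  have key : Zt w = (sum7 fun y => sum7 fun x =>
      iz (ev (lam0 t y * (row w 1).q0 + mu0 t y * (row w t).q0)
        (lam1 t y * (row w 1).q1 + mu1 t y * (row w t).q1)
        (lam2 t y * (row w 1).q2 + mu2 t y * (row w t).q2)
        (lam1 t y * (row w 1).q3 + mu1 t y * (row w t).q3)
        (lam4 t y * (row w 1).q4 + mu4 t y * (row w t).q4) x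
        + (H2 t y * (x * x) * w.d4 + H4 t y * p4 x * w.f4) + H0 t y * w.a4)) := by
    unfold Zt zr
    congr 1
    funext y
    congr 1
    funext x
    congr 1
    obtain ⟨⟨i1, i2, i3⟩, ⟨i4, i5⟩, ⟨i6, i7, i8⟩, ⟨i9, i10, i11⟩⟩ := interp t y h0 h1
    simp only [ev_eq, row, p4, mul_def]
    linear_combination w.a2 * i1 + w.a3 * i2 + w.a4 * i3 + x * (w.b0 * i4 + w.b2 * i5)
      + x ^ 2 * (w.d1 * i6 + w.d2 * i7 + w.d4 * i8) + x ^ 3 * (w.e0 * i4 + w.e2 * i5)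
      + x ^ 4 * (w.f1 * i9 + w.f3 * i10 + w.f4 * i11)
  rw [← key] at h3
  have hle : Zt w ≤ 49 := sum7_le (n := 7) fun y => sum7_le (n := 1) fun x => iz_le _
  generalize Zt w = n at h3 hle
  clear key h'' h' h
  revert h3
  interval_cases n <;> decide

/-! ### Symmetry -/

noncomputable def scale (c s t : K8) (w : Cf) : Cf :=
  ⟨c * t ^ 2 * w.a2, c * t ^ 3 * w.a3, c * t ^ 4 * w.a4,
    c * s * w.b0, c * s * t ^ 2 * w.b2,
    c * s ^ 2 * t * w.d1, c * s ^ 2 * t ^ 2 * w.d2, c * s ^ 2 * t ^ 4 * w.d4,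
    c * s ^ 3 * w.e0, c * s ^ 3 * t ^ 2 * w.e2,
    c * s ^ 4 * t * w.f1, c * s ^ 4 * t ^ 3 * w.f3, c * s ^ 4 * t ^ 4 * w.f4⟩

theorem row_scale (c s t : K8) (w : Cf) (y : K8) :
    row (scale c s t w) y = psc c s (row w (t * y)) := by
  simp only [row, scale, psc, mul_def, P5.mk.injEq]
  refine ⟨?_, ?_, ?_, ?_, ?_⟩ <;> ring

theorem zr_psc (c s : K8) (hc : c ≠ 0) (hs : s ≠ 0) (p : P5) : zr (psc c s p) = zr p := by
  unfold zr
  rw [← sum7_scale (fun x => iz (ev p.q0 p.q1 p.q2 p.q3 p.q4 x)) s hs]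
  congr 1
  funext x
  have e : ev (psc c s p).q0 (psc c s p).q1 (psc c s p).q2 (psc c s p).q3 (psc c s p).q4 x
      = c * ev p.q0 p.q1 p.q2 p.q3 p.q4 (s * x) := by
    simp only [ev_eq, psc, mul_def]; ring
  rw [e, iz_eq, iz_eq]
  simp only [mul_eq_zero, hc, false_or]

theorem Zt_scale (c s t : K8) (hc : c ≠ 0) (hs : s ≠ 0) (ht : t ≠ 0) (w : Cf) :
    Zt (scale c s t w) = Zt w := by
  unfold Zt
  simp only [row_scale, zr_psc c s hc hs]
  exact sum7_scale (fun y => zr (row w y)) t ht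

theorem psc_psc (c s d r : K8) (p : P5) : psc c s (psc d r p) = psc (c * d) (s * r) p := by
  simp only [psc, mul_def, P5.mk.injEq]
  refine ⟨?_, ?_, ?_, ?_, ?_⟩ <;> ring

theorem psc_one (p : P5) : psc 1 1 p = p := by
  simp only [psc, mul_def, one_mul]

theorem psc_pz (c s : K8) : psc c s pz = pz := by
  simp only [psc, pz, mul_def, zero_def, mul_zero]

theorem zr_pz : zr pz = 7 := by decide +kernel

/-! ### Row classification -/

theorem rowOK_normal (a b c d e : K8) (h : (⟨a, b, c, d, e⟩ : P5) ≠ pz) :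
    ∃ z, z ≠ 0 ∧ rowOK (psc z 1 ⟨a, b, c, d, e⟩) = true := by
  have hh := rowCheck_true
  simp only [rowCheck, Bool.and_eq_true] at hh
  obtain ⟨k1, k2, k3, k4, k5⟩ := hh
  simp only [psc, mul_def, one_mul]
  by_cases he : e = 0
  · subst he
    by_cases hd : d = 0
    · subst hd
      by_cases hc : c = 0
      · subst hc
        by_cases hb : b = 0
        · subst hb
          have ha : a ≠ 0 := by rintro rfl; exact h rfl
          refine ⟨a⁻¹, inv_ne_zero ha, ?_⟩
          simp only [inv_mul_cancel₀ ha, mul_zero]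
          exact k5
        · refine ⟨b⁻¹, inv_ne_zero hb, ?_⟩
          simp only [inv_mul_cancel₀ hb, mul_zero]
          exact all8_spec _ k4 _
      · refine ⟨c⁻¹, inv_ne_zero hc, ?_⟩
        simp only [inv_mul_cancel₀ hc, mul_zero]
        exact all8_spec _ (all8_spec _ k3 _) _
    · refine ⟨d⁻¹, inv_ne_zero hd, ?_⟩
      simp only [inv_mul_cancel₀ hd, mul_zero]
      exact all8_spec _ (all8_spec _ (all8_spec _ k2 _) _) _
  · refine ⟨e⁻¹, inv_ne_zero he, ?_⟩
    simp only [inv_mul_cancel₀ he]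
    exact all8_spec _ (all8_spec _ (all8_spec _ (all8_spec _ k1 _) _) _) _

theorem row_class (p : P5) (h : p ≠ pz) :
    zr p ≤ 4 ∧ (3 ≤ zr p → ∃ c, c ≠ 0 ∧ psc c 1 p ∈ L210) ∧
      (zr p = 4 → ∃ c, c ≠ 0 ∧ psc c 1 p ∈ L35) := by
  obtain ⟨z, hz, hr⟩ := rowOK_normal p.q0 p.q1 p.q2 p.q3 p.q4 h
  have hp : zr (psc z 1 p) = zr p := zr_psc z 1 hz one_ne_zero p
  simp only [rowOK, forceN_eq] at hr
  change (Nat.ble (zr (psc z 1 p)) 2 || (memB (psc z 1 p) L210 && (Nat.beq (zr (psc z 1 p)) 3 ||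
    (Nat.beq (zr (psc z 1 p)) 4 && memB (psc z 1 p) L35)))) = true at hr
  rw [hp] at hr
  simp only [Bool.or_eq_true, Bool.and_eq_true] at hr
  rcases hr with hr | ⟨h1, hr | ⟨hr, h2⟩⟩
  · have := Nat.le_of_ble_eq_true hr
    exact ⟨by omega, fun _ => by omega, fun _ => by omega⟩
  · have := Nat.eq_of_beq_eq_true hr
    exact ⟨by omega, fun _ => ⟨z, hz, memB_mem _ _ h1⟩, fun _ => by omega⟩
  · have := Nat.eq_of_beq_eq_true hr
    exact ⟨by omega, fun _ => ⟨z, hz, memB_mem _ _ h1⟩, fun _ => ⟨z, hz, memB_mem _ _ h2⟩⟩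

theorem row_rep (p : P5) (h : p ≠ pz) (h4 : zr p = 4) :
    ∃ c s, c ≠ 0 ∧ s ≠ 0 ∧ psc c s p ∈ L5 := by
  obtain ⟨d, hd, hm⟩ := (row_class p h).2.2 h4
  have h1 := allB_mem _ _ repCheck_true _ hm
  obtain ⟨s, hs, h2⟩ := any7_spec _ h1
  obtain ⟨c, hc, h3⟩ := any7_spec _ h2
  refine ⟨c * d, s, mul_ne_zero hc hd, hs, ?_⟩
  have h5 := memB_mem _ _ h3
  rwa [psc_psc, mul_one] at h5

theorem pigeon (z : K8 → ℕ) (h : ∀ y, z y ≤ 4 ∨ z y = 7) (hs : 23 ≤ sum7 z) :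
    ∃ y1 y2, y1 ≠ 0 ∧ y2 ≠ 0 ∧ y1 ≠ y2 ∧ ((z y1 = 4 ∧ z y2 = 4) ∨ (z y1 = 7 ∧ 3 ≤ z y2)) := by
  by_contra hcon
  push Not at hcon
  rw [sum7_eq] at hs
  have ne : ∀ i j : K8, i ≠ 0 → j ≠ 0 → i ≠ j →
      (z i = 4 → z j ≠ 4) ∧ (z i = 7 → z j < 3) := fun i j a b c => hcon i j a b c
  have key4 : ∀ i : K8, i ≠ 0 → z i ≠ 4 := by
    intro i hi h4
    have B : ∀ j : K8, j ≠ 0 → i = j ∨ z j ≤ 3 := by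
      intro j hj
      by_cases hij : i = j
      · exact Or.inl hij
      · have e1 := h j
        have e2 := (ne i j hi hj hij).1 h4
        have e3 := (ne j i hj hi (Ne.symm hij)).2
        right; omega
    have f1 := B c1 (by decide)
    have f2 := B c2 (by decide)
    have f3 := B c3 (by decide)
    have f4 := B c4 (by decide)
    have f5 := B c5 (by decide)
    have f6 := B c6 (by decide)
    have f7 := B c7 (by decide)
    cases i
    · exact absurd rfl hi
    all_goals
      simp only [reduceCtorEq, false_or, true_or] at f1 f2 f3 f4 f5 f6 f7
      omega
  have key7 : ∀ i : K8, i ≠ 0 → z i ≠ 7 := by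
    intro i hi h7
    have B : ∀ j : K8, j ≠ 0 → i = j ∨ z j ≤ 2 := by
      intro j hj
      by_cases hij : i = j
      · exact Or.inl hij
      · have e2 := (ne i j hi hj hij).2 h7
        right; omega
    have f1 := B c1 (by decide)
    have f2 := B c2 (by decide)
    have f3 := B c3 (by decide)
    have f4 := B c4 (by decide)
    have f5 := B c5 (by decide)
    have f6 := B c6 (by decide)
    have f7 := B c7 (by decide)
    cases i
    · exact absurd rfl hi
    all_goals
      simp only [reduceCtorEq, false_or, true_or] at f1 f2 f3 f4 f5 f6 f7
      omega
  have key : ∀ i : K8, i ≠ 0 → z i < 4 := by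
    intro i hi
    have e1 := h i
    have e2 := key4 i hi
    have e3 := key7 i hi
    omega
  have k1 := key c1 (by decide)
  have k2 := key c2 (by decide)
  have k3 := key c3 (by decide)
  have k4 := key c4 (by decide)
  have k5 := key c5 (by decide)
  have k6 := key c6 (by decide)
  have k7 := key c7 (by decide)
  omega

def cz : Cf := ⟨0, 0, 0, 0, 0, 0, 0, 0, 0, 0, 0, 0, 0⟩

theorem scale_ne (c s t : K8) (hc : c ≠ 0) (hs : s ≠ 0) (ht : t ≠ 0) (w : Cf)
    (h : scale c s t w = cz) : w = cz := by
  obtain ⟨a2, a3, a4, b0, b2, d1, d2, d4, e0, e2, f1, f3, f4⟩ := w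
  simpa [scale, cz, hc, hs, ht] using h

theorem vanish (a b t : K8) (i j : ℕ) (h : t ^ i ≠ t ^ j) (h1 : a + b = 0)
    (h2 : a * t ^ i + b * t ^ j = 0) : a = 0 ∧ b = 0 := by
  have e : b = -a := by linear_combination h1
  have e' : a * (t ^ i - t ^ j) = 0 := by rw [e] at h2; linear_combination h2
  rcases mul_eq_zero.1 e' with h' | h'
  · rw [h', neg_zero] at e
    exact ⟨h', e⟩
  · exact absurd (sub_eq_zero.1 h') h

theorem zero_of (w : Cf) (t : K8) (h0 : t ≠ 0) (h1 : t ≠ 1) (r1 : row w 1 = pz)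
    (rt : row w t = pz) (u0 : w.a4 = 0) (u2 : w.d4 = 0) (u4 : w.f4 = 0) : w = cz := by
  obtain ⟨a2, a3, a4, b0, b2, d1, d2, d4, e0, e2, f1, f3, f4⟩ := w
  simp only at u0 u2 u4
  subst u0 u2 u4
  simp only [row, pz, zero_def, P5.mk.injEq, one_pow, mul_one, zero_mul, add_zero] at r1 rt
  obtain ⟨x1, x2, x3, x4, x5⟩ := r1
  obtain ⟨y1, y2, y3, y4, y5⟩ := rt
  have d23 : t ^ 2 ≠ t ^ 3 := by
    have e2 : t ^ 2 = mul t t := by rw [mul_def]; ring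
    have e3 : t ^ 3 = mul t (mul t t) := by simp only [mul_def]; ring
    rw [e2, e3]; revert h0 h1; cases t <;> decide +kernel
  have d02 : t ^ 0 ≠ t ^ 2 := by
    have e2 : t ^ 2 = mul t t := by rw [mul_def]; ring
    rw [e2, pow_zero]; revert h0 h1; cases t <;> decide +kernel
  have d12 : t ^ 1 ≠ t ^ 2 := by
    have e2 : t ^ 2 = mul t t := by rw [mul_def]; ring
    rw [e2, pow_one]; revert h0 h1; cases t <;> decide +kernel
  have d13 : t ^ 1 ≠ t ^ 3 := by
    have e3 : t ^ 3 = mul t (mul t t) := by simp only [mul_def]; ring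
    rw [e3, pow_one]; revert h0 h1; cases t <;> decide +kernel
  obtain ⟨rfl, rfl⟩ := vanish _ _ t 2 3 d23 x1 y1
  obtain ⟨rfl, rfl⟩ := vanish _ _ t 0 2 d02 x2 (by simpa using y2)
  obtain ⟨rfl, rfl⟩ := vanish _ _ t 1 2 d12 x3 (by simpa using y3)
  obtain ⟨rfl, rfl⟩ := vanish _ _ t 0 2 d02 x4 (by simpa using y4)
  obtain ⟨rfl, rfl⟩ := vanish _ _ t 1 3 d13 x5 (by simpa using y5)
  rfl

theorem psiC_lt (u v z : K8) : psiC u v z < 256 := by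
  cases u <;> cases v <;> cases z <;> decide +kernel

theorem psiC_128 (u v z : K8) (h : ¬ (u = 0 ∧ v = 0 ∧ z = 0)) : psiC u v z = 128 := by
  cases u <;> cases v <;> cases z <;> first | rfl | exact absurd ⟨rfl, rfl, rfl⟩ h

theorem key (w : Cf) (hw : w ≠ cz) : Zt w ≤ 22 := by
  by_contra hcon
  obtain ⟨y1, y2, hy1, hy2, hne, hcase⟩ := pigeon (fun y => zr (row w y)) (fun y => by
    by_cases h : row w y = pz
    · right; rw [h]; exact zr_pz
    · left; exact (row_class _ h).1) (by unfold Zt at hcon; omega)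
  have ht0 : y2 / y1 ≠ 0 := div_ne_zero hy2 hy1
  have ht1 : y2 / y1 ≠ 1 := fun h => hne ((div_eq_one_iff_eq hy1).1 h).symm
  have hy : y1 * (y2 / y1) = y2 := mul_div_cancel₀ y2 hy1
  have hl := chk_loop _ (chk_all _ ht0 ht1)
  simp only [loop, Bool.and_eq_true] at hl
  obtain ⟨hlC, hlB, hlA⟩ := hl
  have sound : ∀ c s, c ≠ 0 → s ≠ 0 → ∀ psi : K8 → K8 → K8 → ℕ, (∀ u v z, psi u v z < 256) →
      psi (scale c s y1 w).a4 (scale c s y1 w).d4 (scale c s y1 w).f4 = 128 →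
      test bias (enc3 psi) (totSum (tab (y2 / y1)) (lam0 (y2 / y1)) (mu0 (y2 / y1))
        (lam1 (y2 / y1)) (mu1 (y2 / y1)) (lam2 (y2 / y1)) (mu2 (y2 / y1)) (lam4 (y2 / y1))
        (mu4 (y2 / y1)) (psc c s (row w y1)) (psc c s (row w y2))) = true → False := by
    intro c s hc hs psi hpsi hu ht
    have h1 : row (scale c s y1 w) 1 = psc c s (row w y1) := by rw [row_scale, mul_one]
    have h2 : row (scale c s y1 w) (y2 / y1) = psc c s (row w y2) := by rw [row_scale, hy]
    rw [← h1, ← h2] at ht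
    have := tot_sound _ _ ht0 ht1 psi hpsi ht hu
    rw [Zt_scale c s y1 hc hs hy1] at this
    exact hcon this
  rcases hcase with ⟨z1, z2⟩ | ⟨z1, z2⟩
  · have n1 : row w y1 ≠ pz := fun h => by rw [h, zr_pz] at z1; omega
    have n2 : row w y2 ≠ pz := fun h => by rw [h, zr_pz] at z2; omega
    obtain ⟨c, s, hc, hs, hm⟩ := row_rep _ n1 z1
    have z2' : zr (psc c s (row w y2)) = 4 := by rw [zr_psc c s hc hs]; exact z2
    have n2' : psc c s (row w y2) ≠ pz := fun h => by rw [h, zr_pz] at z2'; omega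
    obtain ⟨d, hd, hm2⟩ := (row_class _ n2').2.2 z2'
    have h1 := allB_mem _ _ hlA _ hm2
    have h2 := all7_spec _ h1 d⁻¹ (inv_ne_zero hd)
    have h3 := allB_mem _ _ h2 _ hm
    rw [one_def, psc_psc d⁻¹, inv_mul_cancel₀ hd, mul_one, psc_one] at h3
    exact sound c s hc hs (fun _ _ _ => 128) (fun _ _ _ => by norm_num) rfl h3
  · have n1 : row w y1 = pz := by
      by_contra h
      have := (row_class _ h).1
      omega
    by_cases n2 : row w y2 = pz
    · have hp : psiC (scale 1 1 y1 w).a4 (scale 1 1 y1 w).d4 (scale 1 1 y1 w).f4 = 128 := by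
        apply psiC_128
        rintro ⟨u0, u2, u4⟩
        apply hw
        apply scale_ne 1 1 y1 one_ne_zero one_ne_zero hy1
        apply zero_of _ (y2 / y1) ht0 ht1 _ _ u0 u2 u4
        · rw [row_scale, mul_one, n1, psc_pz]
        · rw [row_scale, hy, n2, psc_pz]
      refine sound 1 1 one_ne_zero one_ne_zero psiC psiC_lt hp ?_
      rw [n1, n2, psc_pz]
      exact hlC
    · obtain ⟨c, hc, hm⟩ := (row_class _ n2).2.1 z2
      have h1 := allB_mem _ _ hlB _ hm
      refine sound c 1 hc one_ne_zero (fun _ _ _ => 128) (fun _ _ _ => by norm_num) rfl ?_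
      rw [n1, psc_pz]
      exact h1

end K8

/-! ### Transfer to the Galois field -/

namespace K8

noncomputable def phi : F8 ≃+* K8 :=
  haveI : Fintype F8 := Fintype.ofFinite F8
  FiniteField.ringEquivOfCardEq (by
    rw [← Nat.card_eq_fintype_card, GaloisField.card 2 3 (by norm_num)]
    rfl)

noncomputable def val (w : Cf) (x y : K8) : K8 :=
  ev (row w y).q0 (row w y).q1 (row w y).q2 (row w y).q3 (row w y).q4 x

theorem sum_ne (f : K8 → ℕ) : ∑ x : K8, (if x = 0 then 0 else f x) = sum7 f := by
  have e : (Finset.univ : Finset K8) = {c0, c1, c2, c3, c4, c5, c6, c7} := rfl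
  rw [e]
  simp [← zero_def, sum7_eq]

theorem weight_val (w : Cf) (c : F8ˣ × F8ˣ → F8)
    (h : ∀ x y : F8ˣ, phi (c (x, y)) = val w (phi x) (phi y)) :
    hammingWeight c + Zt w = 49 := by
  have e1 : hammingWeight c =
      Nat.card {q : K8 × K8 // q.2 ≠ 0 ∧ q.1 ≠ 0 ∧ val w q.2 q.1 ≠ 0} := by
    unfold hammingWeight
    refine Nat.card_congr (Equiv.ofBijective
      (fun p => ⟨(phi (p.1.2 : F8), phi (p.1.1 : F8)), ?_, ?_, ?_⟩) ⟨?_, ?_⟩)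
    · exact (map_ne_zero phi).2 p.1.1.ne_zero
    · exact (map_ne_zero phi).2 p.1.2.ne_zero
    · have := h p.1.1 p.1.2
      rw [← this]
      exact (map_ne_zero phi).2 p.2
    · rintro ⟨⟨x, y⟩, hp⟩ ⟨⟨x', y'⟩, hp'⟩ hh
      simp only [Subtype.mk.injEq, Prod.mk.injEq, EmbeddingLike.apply_eq_iff_eq,
        Units.val_inj] at hh ⊢
      exact ⟨hh.2, hh.1⟩
    · rintro ⟨⟨y, x⟩, hx, hy, hv⟩
      simp only at hx hy hv
      have hx' : phi.symm x ≠ 0 := (map_ne_zero phi.symm).2 hx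
      have hy' : phi.symm y ≠ 0 := (map_ne_zero phi.symm).2 hy
      refine ⟨⟨(Units.mk0 _ hx', Units.mk0 _ hy'), ?_⟩, ?_⟩
      · intro h0
        have := h (Units.mk0 _ hx') (Units.mk0 _ hy')
        rw [h0] at this
        simp only [Units.val_mk0, RingEquiv.apply_symm_apply, map_zero] at this
        exact hv this.symm
      · simp
  have e2 : Nat.card {q : K8 × K8 // q.2 ≠ 0 ∧ q.1 ≠ 0 ∧ val w q.2 q.1 ≠ 0} =
      sum7 fun y => sum7 fun x => if val w x y = 0 then 0 else 1 := by
    rw [Nat.card_eq_fintype_card, Fintype.card_subtype, Finset.card_filter,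
      Fintype.sum_prod_type, ← sum_ne]
    refine Finset.sum_congr rfl fun y _ => ?_
    by_cases hy : y = 0
    · simp [hy]
    · rw [if_neg hy, ← sum_ne]
      refine Finset.sum_congr rfl fun x _ => ?_
      by_cases hx : x = 0
      · simp [hx]
      · by_cases hv : val w x y = 0 <;> simp [hx, hy, hv]
  have e3 : (sum7 fun y => sum7 fun x => if val w x y = 0 then 0 else 1) + Zt w =
      sum7 fun y => sum7 fun x => (if val w x y = 0 then 0 else 1) + iz (val w x y) := by
    have e4 : Zt w = sum7 fun y => sum7 fun x => iz (val w x y) := rfl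
    rw [e4]
    simp only [sum7_eq]
    omega
  rw [e1, e2, e3]
  have e5 : ∀ v : K8, (if v = 0 then 0 else 1) + iz v = 1 := by
    intro v; rw [iz_eq]; split <;> rfl
  simp only [e5]
  rfl

/-- The word with given coefficients. -/
noncomputable def word (a : Fin 13 → F8) : F8ˣ × F8ˣ → F8 := fun p =>
  a 0 * evalVec (0,2) p + a 1 * evalVec (0,3) p + a 2 * evalVec (0,4) p
  + a 3 * evalVec (1,0) p + a 4 * evalVec (1,2) p
  + a 5 * evalVec (2,1) p + a 6 * evalVec (2,2) p + a 7 * evalVec (2,4) p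
  + a 8 * evalVec (3,0) p + a 9 * evalVec (3,2) p
  + a 10 * evalVec (4,1) p + a 11 * evalVec (4,3) p + a 12 * evalVec (4,4) p

noncomputable def coef (a : Fin 13 → F8) : Cf :=
  ⟨phi (a 0), phi (a 1), phi (a 2), phi (a 3), phi (a 4), phi (a 5), phi (a 6), phi (a 7),
    phi (a 8), phi (a 9), phi (a 10), phi (a 11), phi (a 12)⟩

theorem word_val (a : Fin 13 → F8) (x y : F8ˣ) :
    phi (word a (x, y)) = val (coef a) (phi x) (phi y) := by
  simp only [word, evalVec, val, ev_eq, row, coef, map_add, map_mul, map_pow]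
  ring

theorem word_mem (a : Fin 13 → F8) : word a ∈ Submodule.span F8 (evalVec '' S) := by
  have hm : ∀ (z : F8) (s : ℕ × ℕ), s ∈ S → (fun p => z * evalVec s p) ∈
      Submodule.span F8 (evalVec '' S) := fun z s hs =>
    Submodule.smul_mem _ z (Submodule.subset_span ⟨s, hs, rfl⟩)
  unfold word
  repeat' refine Submodule.add_mem _ (x := fun p => _) (y := fun p => _) ?_ (hm _ _ (by simp [S]))
  exact hm _ _ (by simp [S])

theorem mem_word (c : F8ˣ × F8ˣ → F8) (hc : c ∈ Submodule.span F8 (evalVec '' S)) :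
    ∃ a, c = word a := by
  induction hc using Submodule.span_induction with
  | mem c h =>
    obtain ⟨s, hs, rfl⟩ := h
    simp only [S, Set.mem_insert_iff, Set.mem_singleton_iff] at hs
    rcases hs with rfl | rfl | rfl | rfl | rfl | rfl | rfl | rfl | rfl | rfl | rfl | rfl | rfl
    · exact ⟨![1,0,0,0,0,0,0,0,0,0,0,0,0], by funext p; simp [word]⟩
    · exact ⟨![0,1,0,0,0,0,0,0,0,0,0,0,0], by funext p; simp [word]⟩
    · exact ⟨![0,0,1,0,0,0,0,0,0,0,0,0,0], by funext p; simp [word]⟩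
    · exact ⟨![0,0,0,1,0,0,0,0,0,0,0,0,0], by funext p; simp [word]⟩
    · exact ⟨![0,0,0,0,1,0,0,0,0,0,0,0,0], by funext p; simp [word]⟩
    · exact ⟨![0,0,0,0,0,1,0,0,0,0,0,0,0], by funext p; simp [word]⟩
    · exact ⟨![0,0,0,0,0,0,1,0,0,0,0,0,0], by funext p; simp [word]⟩
    · exact ⟨![0,0,0,0,0,0,0,1,0,0,0,0,0], by funext p; simp [word]⟩
    · exact ⟨![0,0,0,0,0,0,0,0,1,0,0,0,0], by funext p; simp [word]⟩
    · exact ⟨![0,0,0,0,0,0,0,0,0,1,0,0,0], by funext p; simp [word]⟩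
    · exact ⟨![0,0,0,0,0,0,0,0,0,0,1,0,0], by funext p; simp [word]⟩
    · exact ⟨![0,0,0,0,0,0,0,0,0,0,0,1,0], by funext p; simp [word]⟩
    · exact ⟨![0,0,0,0,0,0,0,0,0,0,0,0,1], by funext p; simp [word]⟩
  | zero => exact ⟨0, by funext p; simp [word]⟩
  | add x y _ _ hx hy =>
    obtain ⟨a, rfl⟩ := hx
    obtain ⟨b, rfl⟩ := hy
    exact ⟨a + b, by funext p; simp only [word, Pi.add_apply]; ring⟩
  | smul z x _ hx =>
    obtain ⟨a, rfl⟩ := hx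
    exact ⟨z • a, by funext p; simp only [word, Pi.smul_apply, smul_eq_mul]; ring⟩

theorem coef_zero (a : Fin 13 → F8) (h : coef a = cz) : word a = 0 := by
  simp only [coef, cz, Cf.mk.injEq, map_eq_zero_iff phi phi.injective] at h
  obtain ⟨h0, h1, h2, h3, h4, h5, h6, h7, h8, h9, h10, h11, h12⟩ := h
  funext p
  simp only [word, h0, h1, h2, h3, h4, h5, h6, h7, h8, h9, h10, h11, h12, zero_mul, add_zero,
    Pi.zero_apply]

/-- Coefficients of a word of weight 27. -/
def wit : Cf := ⟨c3, c7, c4, c0, c0, c6, c7, c1, c0, c0, c5, c4, c1⟩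

theorem wit_Z : Zt wit = 22 := by
  have e2 : ∀ z : K8, z ^ 2 = mul z z := fun z => by rw [mul_def]; ring
  have e3 : ∀ z : K8, z ^ 3 = mul z (mul z z) := fun z => by simp only [mul_def]; ring
  have e4 : ∀ z : K8, z ^ 4 = p4 z := fun z => by simp only [p4, mul_def]; ring
  simp only [Zt, row, e2, e3, e4, ← mul_def, ← add_def]
  decide +kernel

end K8

/-- The generalised toric code `C_S` over `F₈` has minimum distance exactly 27:
every nonzero codeword has Hamming weight at least 27, and some codeword has
Hamming weight exactly 27. -/
theorem min_dist :
    (∀ c ∈ Submodule.span F8 (evalVec '' S), c ≠ 0 → 27 ≤ hammingWeight c) ∧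
    (∃ c ∈ Submodule.span F8 (evalVec '' S), hammingWeight c = 27) := by
  constructor
  · intro c hc hne
    obtain ⟨a, rfl⟩ := K8.mem_word c hc
    have h1 := K8.weight_val (K8.coef a) (K8.word a) (K8.word_val a)
    have h2 := K8.key (K8.coef a) (fun h => hne (K8.coef_zero a h))
    omega
  · let a : Fin 13 → F8 := ![K8.phi.symm K8.wit.a2, K8.phi.symm K8.wit.a3, K8.phi.symm K8.wit.a4,
      K8.phi.symm K8.wit.b0, K8.phi.symm K8.wit.b2, K8.phi.symm K8.wit.d1, K8.phi.symm K8.wit.d2,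
      K8.phi.symm K8.wit.d4, K8.phi.symm K8.wit.e0, K8.phi.symm K8.wit.e2, K8.phi.symm K8.wit.f1,
      K8.phi.symm K8.wit.f3, K8.phi.symm K8.wit.f4]
    have ha : K8.coef a = K8.wit := by
      simp [K8.coef, a]
    refine ⟨K8.word a, K8.word_mem a, ?_⟩
    have h1 := K8.weight_val (K8.coef a) (K8.word a) (K8.word_val a)
    rw [ha, K8.wit_Z] at h1
    omega
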